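/- In the Example-1 economy, every rational expectations solution of E^2_{\{a3,b1}} (the economy with both a3's and b1's arrivals delayed to period 2) matches b1 with a4. Consequently, no rational expectations solution of E^2_{\a3} matches b1 with a1; in particular the matching m* (a1–b1, a2–b2 in period 1; a3–b3, a4–b4 in period 2) does not belong to the rational-expectations conjecture set RE_2(E^2_{\a3}) of agent a3, so the rational expectations conjectures fail the consistency condition at the candidate matching m*. -/

import Mathlib

/-!
A framework for two-sided, one-to-one, irreversible dynamic matching markets
with conjectures, following Doval's "A framework for (dynamic) stability".

Periods are indexed `0, …, T-1` (the paper's periods `1, …, T`).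
-/

namespace DynMatch

open Classical

noncomputable section

/-- A length-`T` two-sided dynamic economy: the arrivals on each side in each period. -/
structure Economy (A B : Type) where
  T : ℕ
  arrA : ℕ → Finset A
  arrB : ℕ → Finset B

/-- Validity of an economy: positive length, pairwise disjoint arrivals, and
no arrivals outside the horizon. -/
def Economy.Valid {A B : Type} (E : Economy A B) : Prop :=
  0 < E.T ∧
  (∀ s t, s ≠ t → Disjoint (E.arrA s) (E.arrA t)) ∧
  (∀ s t, s ≠ t → Disjoint (E.arrB s) (E.arrB t)) ∧
  (∀ s, E.T ≤ s → E.arrA s = ∅) ∧ (∀ s, E.T ≤ s → E.arrB s = ∅)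

/-- A raw dynamic matching: in every period, a partial pairing between the two sides
(`none` means unmatched, i.e. matched to oneself). -/
structure PreMatching (A B : Type) where
  mA : ℕ → A → Option B
  mB : ℕ → B → Option A

variable {A B : Type} [DecidableEq A] [DecidableEq B]

/-- Side-`A` agents having arrived up to (and including) period `t`. -/
def arrAUpTo (E : Economy A B) (t : ℕ) : Finset A := (Finset.range (t+1)).biUnion E.arrA

/-- Side-`B` agents having arrived up to (and including) period `t`. -/
def arrBUpTo (E : Economy A B) (t : ℕ) : Finset B := (Finset.range (t+1)).biUnion E.arrB

/-- `m` is an irreversible dynamic matching for the economy `E`: in every period it is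
an involutive pairing between arrived agents of the two sides, and once matched a
pair stays matched. -/
def IsMatching (E : Economy A B) (m : PreMatching A B) : Prop :=
  (∀ t a b, t < E.T → (m.mA t a = some b ↔ m.mB t b = some a)) ∧
  (∀ t a, t < E.T → m.mA t a ≠ none → a ∈ arrAUpTo E t) ∧
  (∀ t a b, t < E.T → m.mA t a = some b → b ∈ arrBUpTo E t) ∧
  (∀ t s a, t ≤ s → s < E.T → m.mA t a ≠ none → m.mA s a = m.mA t a) ∧
  (∀ t s b, t ≤ s → s < E.T → m.mB t b ≠ none → m.mB s b = m.mB t b)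

/-- The everywhere-unmatched prematching. -/
def emptyM : PreMatching A B := ⟨fun _ _ => none, fun _ _ => none⟩

/-- An agent of the economy: a side-`A` or a side-`B` agent. -/
abbrev Agent (A B : Type) := A ⊕ B

/-- `𝒜_t(m^{t-1})`: side-`A` agents available to match in period `t` given history `m`. -/
def availA (E : Economy A B) (m : PreMatching A B) (t : ℕ) : Finset A :=
  (arrAUpTo E t).filter fun a => ∀ s, s < t → m.mA s a = none

/-- `ℬ_t(m^{t-1})`: side-`B` agents available to match in period `t` given history `m`. -/
def availB (E : Economy A B) (m : PreMatching A B) (t : ℕ) : Finset B :=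
  (arrBUpTo E t).filter fun b => ∀ s, s < t → m.mB s b = none

/-- `k ∈ 𝒜_t(m^{t-1}) ∪ ℬ_t(m^{t-1})`. -/
def isAvail (E : Economy A B) (m : PreMatching A B) (t : ℕ) : Agent A B → Prop
  | Sum.inl a => a ∈ availA E m t
  | Sum.inr b => b ∈ availB E m t

/-- `k ∈ A_1 ∪ B_1`: `k` is a first-period arrival. -/
def inPeriodOne (E : Economy A B) : Agent A B → Prop
  | Sum.inl a => a ∈ E.arrA 0
  | Sum.inr b => b ∈ E.arrB 0

/-- `m_t(k) = k`: agent `k` is unmatched in period `t` under `m`. -/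
def unmatchedAt (m : PreMatching A B) (t : ℕ) : Agent A B → Prop
  | Sum.inl a => m.mA t a = none
  | Sum.inr b => m.mB t b = none

/-- `m` and `m'` agree in all periods `s < t` (i.e. they share the history `m^{t-1}`). -/
def agreeUpTo (m m' : PreMatching A B) (t : ℕ) : Prop :=
  ∀ s, s < t → (∀ a, m.mA s a = m'.mA s a) ∧ (∀ b, m.mB s b = m'.mB s b)

/-- Agent `k` is unmatched through period `t` (all periods `s ≤ t`) under `m`. -/
def unmatchedThrough (m : PreMatching A B) (t : ℕ) : Agent A B → Prop
  | Sum.inl a => ∀ s, s ≤ t → m.mA s a = none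
  | Sum.inr b => ∀ s, s ≤ t → m.mB s b = none

/-- `M_T(m^{t-1})`: matchings of `E` agreeing with `m` through period `t-1`. -/
def MSetH (E : Economy A B) (m : PreMatching A B) (t : ℕ) : Set (PreMatching A B) :=
  {m' | IsMatching E m' ∧ agreeUpTo m m' t}

/-- `M_T(m^{t-1}, k)`: matchings of `E` agreeing with `m` through period `t-1` and
leaving `k` unmatched through period `t`. -/
def MSet (E : Economy A B) (m : PreMatching A B) (t : ℕ) (k : Agent A B) :
    Set (PreMatching A B) :=
  {m' | IsMatching E m' ∧ agreeUpTo m m' t ∧ unmatchedThrough m' t k}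

/-- Preferences: Bernoulli utilities on both sides and discount factors.
(The payoff of remaining single is normalized to `0`.) -/
structure Pref (A B : Type) where
  u : A → B → ℝ
  v : A → B → ℝ
  dA : A → ℝ
  dB : B → ℝ

/-- Discount factors lie in `[0,1]`. -/
def Pref.Valid (P : Pref A B) : Prop :=
  (∀ a, 0 ≤ P.dA a ∧ P.dA a ≤ 1) ∧ (∀ b, 0 ≤ P.dB b ∧ P.dB b ≤ 1)

/-- `t_m(a)`: the first period `s ≥ t` at which `a` is matched under `m` (`T` if never). -/
def matchTimeA (E : Economy A B) (m : PreMatching A B) (t : ℕ) (a : A) : ℕ :=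
  min (sInf {s | t ≤ s ∧ m.mA s a ≠ none}) E.T

/-- `t_m(b)`: the first period `s ≥ t` at which `b` is matched under `m` (`T` if never). -/
def matchTimeB (E : Economy A B) (m : PreMatching A B) (t : ℕ) (b : B) : ℕ :=
  min (sInf {s | t ≤ s ∧ m.mB s b ≠ none}) E.T

/-- `U_t(a,m) = δ_a^{t_m(a)-t}·u(a, m_T(a))` (and `0` if `a` ends up unmatched). -/
def Upay (P : Pref A B) (E : Economy A B) (m : PreMatching A B) (t : ℕ) (a : A) : ℝ :=
  match m.mA (E.T - 1) a with
  | none => 0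
  | some b => P.dA a ^ (matchTimeA E m t a - t) * P.u a b

/-- `V_t(b,m) = δ_b^{t_m(b)-t}·v(m_T(b), b)` (and `0` if `b` ends up unmatched). -/
def Vpay (P : Pref A B) (E : Economy A B) (m : PreMatching A B) (t : ℕ) (b : B) : ℝ :=
  match m.mB (E.T - 1) b with
  | none => 0
  | some a => P.dB b ^ (matchTimeB E m t b - t) * P.v a b

/-- A family of conjectures `Φ`: for every period `t`, history `m^{t-1}` and agent `k`,
a set `φ_t(m^{t-1},k)` of matchings `k` considers possible upon remaining unmatched. -/
abbrev ConjFam (A B : Type) := ℕ → PreMatching A B → Agent A B → Set (PreMatching A B)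

/-- Validity of a family of conjectures for `E`: conjectures are (nonempty) subsets of
`M_T(m^{t-1},k)` and depend on the matching only through the history `m^{t-1}`. -/
def ConjFam.Valid (E : Economy A B) (φ : ConjFam A B) : Prop :=
  (∀ t m k, φ t m k ⊆ MSet E m t k) ∧
  (∀ t m m' k, agreeUpTo m m' t → φ t m k = φ t m' k) ∧
  (∀ t m k, t < E.T → IsMatching E m → isAvail E m t k → (φ t m k).Nonempty)

/-- `m` is a `Φ`-solution for `E` (Definition 3): in every period, every available agent
weakly prefers `m` to some conjectured matching, and no available pair blocks. -/
def IsSolution (P : Pref A B) (E : Economy A B) (φ : ConjFam A B)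
    (m : PreMatching A B) : Prop :=
  IsMatching E m ∧
  ∀ t, t < E.T →
    ((∀ a ∈ availA E m t, ∃ m' ∈ φ t m (Sum.inl a), Upay P E m' t a ≤ Upay P E m t a) ∧
     (∀ b ∈ availB E m t, ∃ m' ∈ φ t m (Sum.inr b), Vpay P E m' t b ≤ Vpay P E m t b) ∧
     (∀ a ∈ availA E m t, ∀ b ∈ availB E m t,
        ¬(P.u a b > Upay P E m t a ∧ P.v a b > Vpay P E m t b)))

/-- `Σ^Φ_T(E)`: the set of `Φ`-solutions of `E`. -/
def SolSet (P : Pref A B) (E : Economy A B) (φ : ConjFam A B) : Set (PreMatching A B) :=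
  {m | IsSolution P E φ m}

/-- The static (Gale–Shapley) notion of stability, for length-1 economies:
individual rationality plus absence of blocking pairs. -/
def Stable1 (P : Pref A B) (E : Economy A B) (m : PreMatching A B) : Prop :=
  IsMatching E m ∧
  (∀ a b, m.mA (E.T - 1) a = some b → 0 ≤ P.u a b) ∧
  (∀ b a, m.mB (E.T - 1) b = some a → 0 ≤ P.v a b) ∧
  (∀ a ∈ E.arrA 0, ∀ b ∈ E.arrB 0,
     ¬(P.u a b > Upay P E m 0 a ∧ P.v a b > Vpay P E m 0 b))

/-- The worst (minimal) period-`t` payoff of `a` over the set `C (inl a)` of matchings. -/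
def wA (P : Pref A B) (E : Economy A B) (t : ℕ)
    (C : Agent A B → Set (PreMatching A B)) (a : A) : ℝ :=
  sInf ((fun m' => Upay P E m' t a) '' C (Sum.inl a))

/-- The worst (minimal) period-`t` payoff of `b` over the set `C (inr b)` of matchings. -/
def wB (P : Pref A B) (E : Economy A B) (t : ℕ)
    (C : Agent A B → Set (PreMatching A B)) (b : B) : ℝ :=
  sInf ((fun m' => Vpay P E m' t b) '' C (Sum.inr b))

/-- Utility of side-`A` agent `a` in the induced one-period economy with outside
option value `W a` (truncated preferences). -/
def indU (P : Pref A B) (W : A → ℝ) (a : A) : Option B → ℝ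
  | none => W a
  | some b => P.u a b

/-- Utility of side-`B` agent `b` in the induced one-period economy with outside
option value `W b` (truncated preferences). -/
def indV (P : Pref A B) (W : B → ℝ) (b : B) : Option A → ℝ
  | none => W b
  | some a => P.v a b

/-- The period-`t` component of `mbar` is a stable matching of the one-period economy
`E_{t,φ}(m^{t-1})` induced by the conjecture profile `C` (Definition 6): matching among
the available agents, individually rational w.r.t. the worst-conjecture thresholds,
and without blocking pairs in the truncated preferences. -/
def StableInduced (P : Pref A B) (E : Economy A B) (m : PreMatching A B) (t : ℕ)
    (C : Agent A B → Set (PreMatching A B)) (mbar : PreMatching A B) : Prop :=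
  (∀ a ∈ availA E m t, ∀ b, mbar.mA t a = some b → b ∈ availB E m t ∧ mbar.mB t b = some a) ∧
  (∀ b ∈ availB E m t, ∀ a, mbar.mB t b = some a → a ∈ availA E m t ∧ mbar.mA t a = some b) ∧
  (∀ a ∈ availA E m t, ∀ b, mbar.mA t a = some b → wA P E t C a ≤ P.u a b) ∧
  (∀ b ∈ availB E m t, ∀ a, mbar.mB t b = some a → wB P E t C b ≤ P.v a b) ∧
  (∀ a ∈ availA E m t, ∀ b ∈ availB E m t,
     ¬(P.u a b > indU P (wA P E t C) a (mbar.mA t a) ∧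
       P.v a b > indV P (wB P E t C) b (mbar.mB t b)))

/-- `mbar_t` is stable among those who match in period `t` relative to the conjecture
profile `C` (Definition 7): every available agent matched in period `t` weakly prefers
its partner to its worst conjectured matching, and no pair of agents both matched in
period `t` blocks. -/
def StableAmongMatched (P : Pref A B) (E : Economy A B) (m : PreMatching A B) (t : ℕ)
    (C : Agent A B → Set (PreMatching A B)) (mbar : PreMatching A B) : Prop :=
  (∀ a ∈ availA E m t, ∀ b, mbar.mA t a = some b → wA P E t C a ≤ P.u a b) ∧
  (∀ b ∈ availB E m t, ∀ a, mbar.mB t b = some a → wB P E t C b ≤ P.v a b) ∧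
  (∀ a ∈ availA E m t, ∀ b ∈ availB E m t, ∀ b' a',
     mbar.mA t a = some b' → mbar.mB t b = some a' →
     ¬(P.u a b > P.u a b' ∧ P.v a b > P.v a' b))

/-- `E_t^T(m^{t-1})`: the continuation economy starting at period `t` given history `m`:
its first-period arrivals are the agents available at `t`, later arrivals are unchanged. -/
def contEconomy (E : Economy A B) (m : PreMatching A B) (t : ℕ) : Economy A B where
  T := E.T - t
  arrA := fun s => if s = 0 then availA E m t else E.arrA (t + s)
  arrB := fun s => if s = 0 then availB E m t else E.arrB (t + s)

/-- The restriction of `m` to the continuation economy starting in period `t`: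
time is shifted by `t` and agents matched strictly before `t` are dropped. -/
def restrictM (m : PreMatching A B) (t : ℕ) : PreMatching A B where
  mA := fun s a => if ∀ s', s' < t → m.mA s' a = none then m.mA (t + s) a else none
  mB := fun s b => if ∀ s', s' < t → m.mB s' b = none then m.mB (t + s) b else none

/-- The matching of the original economy corresponding to history `m` through period
`t-1` followed by the continuation matching `m'` (indexed from `0`) of the
continuation economy. -/
def splice (m m' : PreMatching A B) (t : ℕ) : PreMatching A B where
  mA := fun s a => if s < t then m.mA s a
    else if ∀ s', s' < t → m.mA s' a = none then m'.mA (s - t) a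
    else m.mA (t - 1) a
  mB := fun s b => if s < t then m.mB s b
    else if ∀ s', s' < t → m.mB s' b = none then m'.mB (s - t) b
    else m.mB (t - 1) b

/-- The family of conjectures that the family `φ` of the original economy induces on the
continuation economy `E_t^T(m^{t-1})`: at a continuation history, it is the (restriction
of the) original conjectures at the corresponding original history. -/
def contConj (E : Economy A B) (φ : ConjFam A B) (m : PreMatching A B) (t : ℕ) :
    ConjFam A B :=
  fun s mbar k => (fun m' => restrictM m' t) '' φ (t + s) (splice m mbar t) k

/-- The conjectures of eq. (2): the agent only rules out continuation matchings that do
not conform with the solution concept `S` from tomorrow onward. -/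
def starConj (S : Economy A B → Set (PreMatching A B)) (E : Economy A B) : ConjFam A B :=
  fun t m k =>
    {m' | m' ∈ MSet E m t k ∧ restrictM m' (t+1) ∈ S (contEconomy E m' (t+1))}

/-- `S` is the solution correspondence `Σ*` recursively generated by the conjectures of
eq. (2): stability for one-period economies, `Φ*`-solutions for longer economies
(empty continuations impose no restriction). -/
def IsStarFamily (P : Pref A B) (S : Economy A B → Set (PreMatching A B)) : Prop :=
  (∀ E : Economy A B, E.T = 0 → S E = Set.univ) ∧
  (∀ E : Economy A B, E.T = 1 → S E = {m | Stable1 P E m}) ∧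
  (∀ E : Economy A B, 2 ≤ E.T → S E = SolSet P E (starConj S E))

/-- The decreasing recursion defining the CVR conjectures at period `t`, history `m`,
relative to the continuation solution correspondence `DS`. -/
def cvrIter (P : Pref A B) (E : Economy A B)
    (DS : Economy A B → Set (PreMatching A B)) (t : ℕ) (m : PreMatching A B) :
    ℕ → Agent A B → Set (PreMatching A B)
  | 0 => fun k => MSet E m t k
  | n+1 => fun k =>
      {mbar | mbar ∈ MSet E m t k ∧
        StableAmongMatched P E m t (cvrIter P E DS t m n) mbar ∧
        restrictM mbar (t+1) ∈ DS (contEconomy E mbar (t+1))}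

/-- The CVR conjectures `φ_{D̂S,t}(m^{t-1},·)`: the limit (intersection) of the
decreasing recursion `cvrIter`. -/
def cvrConj (P : Pref A B) (DS : Economy A B → Set (PreMatching A B))
    (E : Economy A B) : ConjFam A B :=
  fun t m k => ⋂ n, cvrIter P E DS t m n k

/-- `DS` is the CVR-dynamic-stability correspondence `D̂S`: stable matchings for
one-period economies, `Φ_{D̂S}`-solutions for longer economies. -/
def IsCVRFamily (P : Pref A B) (DS : Economy A B → Set (PreMatching A B)) : Prop :=
  (∀ E : Economy A B, E.T = 0 → DS E = Set.univ) ∧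
  (∀ E : Economy A B, E.T = 1 → DS E = {m | Stable1 P E m}) ∧
  (∀ E : Economy A B, 2 ≤ E.T → DS E = SolSet P E (cvrConj P DS E))

/-- The dynamic-stability conjectures of Doval (2022): the period-`t` matching is stable
among those who match relative to individually rational continuation values, and the
continuation is dynamically stable. -/
def dsConj (P : Pref A B) (DSol : Economy A B → Set (PreMatching A B))
    (E : Economy A B) : ConjFam A B :=
  fun t m k =>
    {mbar | mbar ∈ MSet E m t k ∧
      (∀ a ∈ availA E m t, ∀ b, mbar.mA t a = some b → 0 ≤ P.u a b) ∧
      (∀ b ∈ availB E m t, ∀ a, mbar.mB t b = some a → 0 ≤ P.v a b) ∧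
      (∀ a ∈ availA E m t, ∀ b ∈ availB E m t, ∀ b' a',
         mbar.mA t a = some b' → mbar.mB t b = some a' →
         ¬(P.u a b > P.u a b' ∧ P.v a b > P.v a' b)) ∧
      restrictM mbar (t+1) ∈ DSol (contEconomy E mbar (t+1))}

/-- `DSol` is the dynamic-stability correspondence `DS` of Doval (2022). -/
def IsDSFamily (P : Pref A B) (DSol : Economy A B → Set (PreMatching A B)) : Prop :=
  (∀ E : Economy A B, E.T = 0 → DSol E = Set.univ) ∧
  (∀ E : Economy A B, E.T = 1 → DSol E = {m | Stable1 P E m}) ∧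
  (∀ E : Economy A B, 2 ≤ E.T → DSol E = SolSet P E (dsConj P DSol E))

/-- `E_{\k}`: the economy identical to `E` except that agent `k`'s arrival is delayed
by one period (from period `0` to period `1`). -/
def delayEconomy (E : Economy A B) : Agent A B → Economy A B
  | Sum.inl a =>
      { T := E.T
        arrA := fun s => if s = 0 then E.arrA 0 \ {a}
                 else if s = 1 then insert a (E.arrA 1) else E.arrA s
        arrB := E.arrB }
  | Sum.inr b =>
      { T := E.T
        arrA := E.arrA
        arrB := fun s => if s = 0 then E.arrB 0 \ {b}
                 else if s = 1 then insert b (E.arrB 1) else E.arrB s }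

/-- The candidate set `M*(m^{t-1}, C, Scont)`: matchings whose period-`t` matching is
stable in the one-period economy induced by the continuation-value sets `C`, and whose
continuation lies in `Scont` of the induced continuation economy. -/
def candT (P : Pref A B) (Scont : Economy A B → Set (PreMatching A B))
    (E : Economy A B) (t : ℕ) (m : PreMatching A B)
    (C : Agent A B → Set (PreMatching A B)) : Set (PreMatching A B) :=
  {mbar | mbar ∈ MSetH E m t ∧ StableInduced P E m t C mbar ∧
    restrictM mbar (t+1) ∈ Scont (contEconomy E mbar (t+1))}

/-- The increasing recursion `F_n` defining the sophisticated-dynamic-stability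
conjectures at period `t`, history `m`, relative to the correspondence `SDS` on
strictly shorter problems. -/
def sdsF (P : Pref A B) (SDS : Economy A B → Set (PreMatching A B))
    (E : Economy A B) (t : ℕ) (m : PreMatching A B) :
    ℕ → Agent A B → Set (PreMatching A B)
  | 0 => fun k =>
      {mbar | mbar ∈ MSet E m t k ∧
        restrictM mbar t ∈ SDS (delayEconomy (contEconomy E m t) k)}
  | n+1 => fun k => sdsF P SDS E t m n k ∪
      {mbar | mbar ∈ candT P SDS E t m (sdsF P SDS E t m n) ∧ unmatchedAt mbar t k}

/-- The SDS conjectures `φ_{SDS,t}`: the limit (union) of the increasing recursion `F_n`. -/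
def sdsConj (P : Pref A B) (SDS : Economy A B → Set (PreMatching A B))
    (E : Economy A B) : ConjFam A B :=
  fun t m k => ⋃ n, sdsF P SDS E t m n k

/-- `SDS` is the sophisticated-dynamic-stability correspondence. -/
def IsSDSFamily (P : Pref A B) (SDS : Economy A B → Set (PreMatching A B)) : Prop :=
  (∀ E : Economy A B, E.T = 0 → SDS E = Set.univ) ∧
  (∀ E : Economy A B, E.T = 1 → SDS E = {m | Stable1 P E m}) ∧
  (∀ E : Economy A B, 2 ≤ E.T → SDS E = SolSet P E (sdsConj P SDS E))

/-- The rational-expectations conjectures: `k` conjectures exactly the `RE` solutions of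
the continuation economy in which `k`'s arrival is delayed by one period. -/
def reConj (RE : Economy A B → Set (PreMatching A B)) (E : Economy A B) : ConjFam A B :=
  fun t m k =>
    {mbar | mbar ∈ MSet E m t k ∧
      restrictM mbar t ∈ RE (delayEconomy (contEconomy E m t) k)}

/-- `RE` is the rational-expectations solution correspondence. -/
def IsREFamily (P : Pref A B) (RE : Economy A B → Set (PreMatching A B)) : Prop :=
  (∀ E : Economy A B, E.T = 1 → RE E = {m | Stable1 P E m}) ∧
  (∀ E : Economy A B, 2 ≤ E.T → RE E = SolSet P E (reConj RE E))


/-! ### The Example-1 economy.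
Side-`A` agents `a1,…,a4` are `0,…,3 : Fin 4`; side-`B` agents `b1,…,b4` are
`0,…,3 : Fin 4`. Arrivals: `A_1 = {a1,a2,a3}`, `B_1 = {b1,b2}`, `A_2 = {a4}`,
`B_2 = {b3,b4}`. -/

/-- The Example-1 economy. -/
def E1 : Economy (Fin 4) (Fin 4) where
  T := 2
  arrA := fun s => if s = 0 then {0, 1, 2} else if s = 1 then {3} else ∅
  arrB := fun s => if s = 0 then {0, 1} else if s = 1 then {2, 3} else ∅

/-- `P` realizes the strict rankings of discounted payoffs of Example 1
(unlisted partners are unacceptable, i.e. have negative utility; `a2` and `b1`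
have discount factors below but close enough to `1` that a better static partner is
preferred regardless of timing). -/
def Ex1Pref (P : Pref (Fin 4) (Fin 4)) : Prop :=
  P.Valid ∧
  -- a1: (b4,0) ≻ (b2,0) ≻ (b1,0) ≻ (b4,1) ≻ all else
  (P.u 0 3 > P.u 0 1 ∧ P.u 0 1 > P.u 0 0 ∧ P.u 0 0 > P.dA 0 * P.u 0 3 ∧
    P.dA 0 * P.u 0 3 > P.dA 0 * P.u 0 1 ∧ P.dA 0 * P.u 0 3 > P.dA 0 * P.u 0 0 ∧
    P.dA 0 * P.u 0 3 > P.u 0 2 ∧ P.dA 0 * P.u 0 3 > P.dA 0 * P.u 0 2 ∧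
    P.dA 0 * P.u 0 3 > 0 ∧ P.u 0 2 < 0) ∧
  -- a2: b3 ≻ b4 ≻ b2 ≻ b1, δ close to 1
  (P.dA 1 < 1 ∧ (∀ j j' : Fin 4, P.u 1 j > P.u 1 j' → P.dA 1 * P.u 1 j > P.u 1 j') ∧
    P.u 1 2 > P.u 1 3 ∧ P.u 1 3 > P.u 1 1 ∧ P.u 1 1 > P.u 1 0 ∧ P.u 1 0 > 0) ∧
  -- a3: (b3,0) ≻ (b2,0) ≻ (b3,1) ≻ all else
  (P.u 2 2 > P.u 2 1 ∧ P.u 2 1 > P.dA 2 * P.u 2 2 ∧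
    P.dA 2 * P.u 2 2 > P.dA 2 * P.u 2 1 ∧ P.dA 2 * P.u 2 2 > P.u 2 0 ∧
    P.dA 2 * P.u 2 2 > P.dA 2 * P.u 2 0 ∧ P.dA 2 * P.u 2 2 > P.u 2 3 ∧
    P.dA 2 * P.u 2 2 > P.dA 2 * P.u 2 3 ∧ P.dA 2 * P.u 2 2 > 0 ∧
    P.u 2 0 < 0 ∧ P.u 2 3 < 0) ∧
  -- a4: b3 ≻ b1 ≻ b4, b2 unacceptable
  (P.u 3 2 > P.u 3 0 ∧ P.u 3 0 > P.u 3 3 ∧ P.u 3 3 > 0 ∧ P.u 3 1 < 0) ∧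
  -- b1: a4 ≻ a1 ≻ a2, δ close to 1, a3 unacceptable
  (P.dB 0 < 1 ∧ (∀ i i' : Fin 4, P.v i 0 > P.v i' 0 → P.dB 0 * P.v i 0 > P.v i' 0) ∧
    P.v 3 0 > P.v 0 0 ∧ P.v 0 0 > P.v 1 0 ∧ P.v 1 0 > 0 ∧ P.v 2 0 < 0) ∧
  -- b2: (a2,0) ≻ (a2,1) ≻ (a3,0) ≻ (a1,0) ≻ (a3,1) ≻ all else
  (P.v 1 1 > P.dB 1 * P.v 1 1 ∧ P.dB 1 * P.v 1 1 > P.v 2 1 ∧ P.v 2 1 > P.v 0 1 ∧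
    P.v 0 1 > P.dB 1 * P.v 2 1 ∧ P.dB 1 * P.v 2 1 > P.dB 1 * P.v 0 1 ∧
    P.dB 1 * P.v 2 1 > P.v 3 1 ∧ P.dB 1 * P.v 2 1 > P.dB 1 * P.v 3 1 ∧
    P.dB 1 * P.v 2 1 > 0 ∧ P.v 3 1 < 0) ∧
  -- b3: a3 ≻ a4 ≻ a2, a1 unacceptable
  (P.v 2 2 > P.v 3 2 ∧ P.v 3 2 > P.v 1 2 ∧ P.v 1 2 > 0 ∧ P.v 0 2 < 0) ∧
  -- b4: a4 ≻ a2 ≻ a1, a3 unacceptable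
  (P.v 3 3 > P.v 1 3 ∧ P.v 1 3 > P.v 0 3 ∧ P.v 0 3 > 0 ∧ P.v 2 3 < 0)

/-- The candidate matching `m*`: `a1–b1`, `a2–b2` in period 1; `a3–b3`, `a4–b4` in
period 2. -/
def mstar1 : PreMatching (Fin 4) (Fin 4) where
  mA := fun t a => if t = 0 then (if a = 0 ∨ a = 1 then some a else none) else some a
  mB := fun t b => if t = 0 then (if b = 0 ∨ b = 1 then some b else none) else some b

@[simp] lemma delayEconomy_T (E : Economy A B) (k : Agent A B) :
    (delayEconomy E k).T = E.T := by
  cases k <;> rfl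

lemma contEconomy_zero (E : Economy A B) (m : PreMatching A B) : contEconomy E m 0 = E := by
  have hA : (contEconomy E m 0).arrA = E.arrA := by
    funext s
    by_cases hs : s = 0 <;> simp [contEconomy, availA, arrAUpTo, hs]
  have hB : (contEconomy E m 0).arrB = E.arrB := by
    funext s
    by_cases hs : s = 0 <;> simp [contEconomy, availB, arrBUpTo, hs]
  cases E
  simp_all [contEconomy]

lemma restrictM_zero {α β : Type} (m : PreMatching α β) : restrictM m 0 = m := by
  simp [restrictM]

lemma mem_of_mem_reConj_zero {RE : Economy A B → Set (PreMatching A B)} {E : Economy A B}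
    {m m' : PreMatching A B} {k : Agent A B} (h : m' ∈ reConj RE E 0 m k) :
    m' ∈ RE (delayEconomy E k) := by
  simpa only [contEconomy_zero, restrictM_zero] using h.2

lemma matchTimeA_of_ne_none {α β : Type} {E : Economy α β} {m : PreMatching α β}
    {s t : ℕ} {a : α} (hst : t ≤ s) (hs : s < E.T) (hm : m.mA s a ≠ none)
    (hlt : ∀ r, t ≤ r → r < s → m.mA r a = none) : matchTimeA E m t a = s := by
  have h : IsLeast {r | t ≤ r ∧ m.mA r a ≠ none} s :=
    ⟨⟨hst, hm⟩, fun r hr => not_lt.1 fun hrs => hr.2 (hlt r hr.1 hrs)⟩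
  rw [matchTimeA, h.csInf_eq, min_eq_left hs.le]

lemma matchTimeB_of_ne_none {α β : Type} {E : Economy α β} {m : PreMatching α β}
    {s t : ℕ} {b : β} (hst : t ≤ s) (hs : s < E.T) (hm : m.mB s b ≠ none)
    (hlt : ∀ r, t ≤ r → r < s → m.mB r b = none) : matchTimeB E m t b = s := by
  have h : IsLeast {r | t ≤ r ∧ m.mB r b ≠ none} s :=
    ⟨⟨hst, hm⟩, fun r hr => not_lt.1 fun hrs => hr.2 (hlt r hr.1 hrs)⟩
  rw [matchTimeB, h.csInf_eq, min_eq_left hs.le]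

lemma Upay_last {α β : Type} (P : Pref α β) {E : Economy α β} (m : PreMatching α β) {t : ℕ}
    (hT : E.T = t + 1) (a : α) : Upay P E m t a = (m.mA t a).elim 0 (P.u a) := by
  cases h : m.mA t a with
  | none => simp [Upay, hT, h]
  | some b =>
    have ht : matchTimeA E m t a = t :=
      matchTimeA_of_ne_none le_rfl (by omega) (by simp [h]) (by omega)
    simp [Upay, hT, h, ht]

lemma Vpay_last {α β : Type} (P : Pref α β) {E : Economy α β} (m : PreMatching α β) {t : ℕ}
    (hT : E.T = t + 1) (b : β) : Vpay P E m t b = (m.mB t b).elim 0 fun a => P.v a b := by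
  cases h : m.mB t b with
  | none => simp [Vpay, hT, h]
  | some a =>
    have ht : matchTimeB E m t b = t :=
      matchTimeB_of_ne_none le_rfl (by omega) (by simp [h]) (by omega)
    simp [Vpay, hT, h, ht]

/-- In the last period of a solution, two available agents who strictly prefer each other to
every other attainable outcome are matched. -/
lemma IsSolution.mA_eq_of_mutual_best {P : Pref A B} {E : Economy A B} {φ : ConjFam A B}
    {m : PreMatching A B} (h : IsSolution P E φ m) {t : ℕ} (hT : E.T = t + 1) {a : A} {b : B}
    (ha : a ∈ availA E m t) (hb : b ∈ availB E m t) (hu : 0 < P.u a b) (hv : 0 < P.v a b)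
    (hu' : ∀ b', m.mA t a = some b' → b' ≠ b → P.u a b' < P.u a b)
    (hv' : ∀ a', m.mB t b = some a' → a' ≠ a → P.v a' b < P.v a b) :
    m.mA t a = some b := by
  by_contra hne
  have hne' : m.mB t b ≠ some a := fun h' => hne ((h.1.1 t a b (by omega)).2 h')
  refine (h.2 t (by omega)).2.2 a ha b hb ⟨?_, ?_⟩
  · rw [Upay_last P m hT]
    cases hm : m.mA t a with
    | none => exact hu
    | some b' => exact hu' b' hm fun e => hne (e ▸ hm)
  · rw [Vpay_last P m hT]
    cases hm : m.mB t b with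
    | none => exact hv
    | some a' => exact hv' a' hm fun e => hne' (e ▸ hm)

lemma IsMatching.mem_availA_one {E : Economy A B} {m : PreMatching A B} (h : IsMatching E m)
    (hT : E.T = 2) {a : A} (h0 : a ∉ E.arrA 0) (h1 : a ∈ E.arrA 1) : a ∈ availA E m 1 := by
  refine Finset.mem_filter.2 ⟨Finset.mem_biUnion.2 ⟨1, by simp, h1⟩, fun s hs => ?_⟩
  obtain rfl : s = 0 := by omega
  by_contra hm
  exact h0 (by simpa [arrAUpTo] using h.2.1 0 a (by omega) hm)

lemma IsMatching.mem_availB_one {E : Economy A B} {m : PreMatching A B} (h : IsMatching E m)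
    (hT : E.T = 2) {b : B} (h0 : b ∉ E.arrB 0) (h1 : b ∈ E.arrB 1) : b ∈ availB E m 1 := by
  refine Finset.mem_filter.2 ⟨Finset.mem_biUnion.2 ⟨1, by simp, h1⟩, fun s hs => ?_⟩
  obtain rfl : s = 0 := by omega
  cases hm : m.mB 0 b with
  | none => rfl
  | some a =>
    have hb := h.2.2.1 0 a b (by omega) ((h.1 0 a b (by omega)).2 hm)
    exact absurd (by simpa [arrBUpTo] using hb) h0

/-- With both `a3` and `b1` delayed, `b1` and `a4` are matched in the second period. -/
lemma mB_b1_eq_a4_of_delayed {P : Pref (Fin 4) (Fin 4)} (hP : Ex1Pref P)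
    {φ : ConjFam (Fin 4) (Fin 4)} {m : PreMatching (Fin 4) (Fin 4)}
    (h : IsSolution P (delayEconomy (delayEconomy E1 (Sum.inl 2)) (Sum.inr 0)) φ m) :
    m.mB 1 0 = some 3 := by
  obtain ⟨hV, -, -, ha3, ha4, hb1, -, hb3, -⟩ := hP
  have hT : (delayEconomy (delayEconomy E1 (Sum.inl 2)) (Sum.inr 0)).T = 2 := rfl
  have hδ := hV.1 2
  have hu22 : 0 < P.u 2 2 := by nlinarith
  have hd : P.dA 2 * P.u 2 2 ≤ P.u 2 2 := by nlinarith
  have h33 : m.mA 1 2 = some 2 := by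
    refine h.mA_eq_of_mutual_best hT
      (h.1.mem_availA_one hT (by simp [delayEconomy, E1]) (by simp [delayEconomy, E1]))
      (h.1.mem_availB_one hT (by simp [delayEconomy, E1]) (by simp [delayEconomy, E1]))
      hu22 (by linarith) ?_ ?_
    · intro b _ hb
      fin_cases b <;> first | exact absurd rfl hb | (simp; linarith)
    · intro a _ ha
      fin_cases a <;> first | exact absurd rfl ha | (simp; linarith)
  refine (h.1.1 1 3 0 hT.ge).1 (h.mA_eq_of_mutual_best hT
      (h.1.mem_availA_one hT (by simp [delayEconomy, E1]) (by simp [delayEconomy, E1]))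
      (h.1.mem_availB_one hT (by simp [delayEconomy, E1]) (by simp [delayEconomy, E1]))
      (by linarith) (by linarith) ?_ ?_)
  · intro b hm hb
    have hb2 : b ≠ 2 := by
      rintro rfl
      have e1 := (h.1.1 1 3 2 hT.ge).1 hm
      have e2 := (h.1.1 1 2 2 hT.ge).1 h33
      simp [e1] at e2
    fin_cases b <;> first | exact absurd rfl hb | exact absurd rfl hb2 | (simp; linarith)
  · intro a _ ha
    fin_cases a <;> first | exact absurd rfl ha | (simp; linarith)

/-- every rational expectations solution of `E²_{\{a3,b1\}}` matches `b1`
with `a4`; consequently no rational expectations solution of `E²_{\a3}` matches `b1`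
with `a1`; in particular `m*` is not a rational-expectations conjecture of agent `a3`,
so the rational expectations conjectures fail the consistency condition at `m*`. -/
theorem statement16 (P : Pref (Fin 4) (Fin 4)) (hP : Ex1Pref P)
    (RE : Economy (Fin 4) (Fin 4) → Set (PreMatching (Fin 4) (Fin 4)))
    (hRE : IsREFamily P RE) :
    (∀ m ∈ RE (delayEconomy (delayEconomy E1 (Sum.inl 2)) (Sum.inr 0)),
        m.mB 1 0 = some 3) ∧
    (∀ m ∈ RE (delayEconomy E1 (Sum.inl 2)), m.mB 1 0 ≠ some 0) ∧
    mstar1 ∉ reConj RE E1 0 mstar1 (Sum.inl 2) ∧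
    ¬(∀ k : Agent (Fin 4) (Fin 4), inPeriodOne E1 k → unmatchedAt mstar1 0 k →
        mstar1 ∈ reConj RE E1 0 mstar1 k) := by
  have hT2 : ∀ E : Economy (Fin 4) (Fin 4), E.T = 2 → RE E = SolSet P E (reConj RE E) :=
    fun E hE => hRE.2 E hE.ge
  have h_both : ∀ m ∈ RE (delayEconomy (delayEconomy E1 (Sum.inl 2)) (Sum.inr 0)),
      m.mB 1 0 = some 3 := by
    intro m hm
    rw [hT2 _ rfl] at hm
    exact mB_b1_eq_a4_of_delayed hP hm
  have h_a3 : ∀ m ∈ RE (delayEconomy E1 (Sum.inl 2)), m.mB 1 0 ≠ some 0 := by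
    intro m hm h0
    rw [hT2 _ rfl] at hm
    obtain ⟨m', hm', hle⟩ := (hm.2 0 (by simp [E1])).2.1 0
      (by simp [availB, arrBUpTo, delayEconomy, E1])
    have h3 := h_both m' (mem_of_mem_reConj_zero hm')
    have h_none : m'.mB 0 0 = none := hm'.1.2.2 0 le_rfl
    have ht : matchTimeB (delayEconomy E1 (Sum.inl 2)) m' 0 0 = 1 := by
      refine matchTimeB_of_ne_none zero_le_one (by simp [E1]) (by simp [h3]) fun r _ hr => ?_
      obtain rfl : r = 0 := by omega
      exact h_none
    have hTm : (delayEconomy E1 (Sum.inl 2)).T - 1 = 1 := rfl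
    simp only [Vpay, hTm, h3, h0, ht, Nat.sub_zero, pow_one] at hle
    obtain ⟨hV, -, -, -, -, ⟨-, hδ, h30, h01, h10, -⟩, -⟩ := hP
    have hpow := pow_le_one₀ (n := matchTimeB (delayEconomy E1 (Sum.inl 2)) m 0 0)
      (hV.2 0).1 (hV.2 0).2
    have := mul_le_of_le_one_left (h10.trans h01).le hpow
    linarith [hδ 3 0 h30]
  have h_star : mstar1 ∉ reConj RE E1 0 mstar1 (Sum.inl 2) := fun h =>
    h_a3 mstar1 (mem_of_mem_reConj_zero h) rfl
  exact ⟨h_both, h_a3, h_star, fun h =>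
    h_star (h (Sum.inl 2) (by simp [inPeriodOne, E1]) (by simp [unmatchedAt, mstar1]))⟩

end

end DynMatch
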